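/- arXiv:1210.2325 — 5 statements merged into one kernel-verified Lean document; each statement's English description precedes it below -/
import Mathlib

section
/- Let d ≥ 1, let p ∈ ℝ^d, and let g : ℝ^d × ℝ → ℝ^d × ℝ, written g(x,y) = (g_x(x,y), g_y(x,y)), be C^∞ on U ∩ (ℝ^d × [0,∞)) for some open neighborhood U of (p,0) (in the sense of ContDiffOn within the closed half-space). Assume g_y(x,0) = 0 for all x with (x,0) ∈ U, that g maps U ∩ (ℝ^d × [0,∞)) into ℝ^d × [0,∞), and that ∂g_y/∂y(p,0) > 0. Define Φ(x,y) = (x, φ(y)) for y > 0 and Φ(x,0) = (x,0), where φ(y) = exp(−1/y). Then the conjugated map Φ⁻¹ ∘ g ∘ Φ, i.e. the map sending (x,y) with y > 0 to (g_x(x, φ(y)), ψ(g_y(x, φ(y)))) where ψ(s) = −1/log(s), extended by (x,0) ↦ (g_x(x,0), 0), is C^∞ within ℝ^d × [0,∞) at the point (p,0). -/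
open Set Filter Topology
open scoped ContDiff

universe u

section ParametricIntegral

/-- The partial derivative in the first variable, integrated over the second one, is the
derivative of the parametric integral. -/
theorem hasFDerivAt_parametric_intervalIntegral {E F : Type*} [NormedAddCommGroup E]
    [NormedSpace ℝ E] [ProperSpace E] [NormedAddCommGroup F] [NormedSpace ℝ F]
    {f : E × ℝ → F} (hf : ContDiff ℝ 1 f) (a b : ℝ) (x₀ : E) :
    HasFDerivAt (fun x => ∫ t in a..b, f (x, t))
      (∫ t in a..b, (fderiv ℝ f (x₀, t)).comp (ContinuousLinearMap.inl ℝ E ℝ)) x₀ := by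
  have hcont : Continuous fun q : E × ℝ =>
      (fderiv ℝ f q).comp (ContinuousLinearMap.inl ℝ E ℝ) :=
    (hf.continuous_fderiv one_ne_zero).clm_comp continuous_const
  obtain ⟨C, hC⟩ := ((isCompact_closedBall x₀ 1).prod
    (isCompact_uIcc (a := a) (b := b))).exists_bound_of_continuousOn hcont.continuousOn
  refine intervalIntegral.hasFDerivAt_integral_of_dominated_of_fderiv_le
    (F' := fun x t => (fderiv ℝ f (x, t)).comp (ContinuousLinearMap.inl ℝ E ℝ))
    (bound := fun _ => C) (Metric.closedBall_mem_nhds x₀ one_pos)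
    (Eventually.of_forall fun x => ?_) ?_ ?_ ?_ intervalIntegrable_const ?_
  · exact (hf.continuous.comp (Continuous.prodMk_right x)).aestronglyMeasurable
  · exact (hf.continuous.comp (Continuous.prodMk_right x₀)).intervalIntegrable a b
  · exact (hcont.comp (Continuous.prodMk_right x₀)).aestronglyMeasurable
  · exact Eventually.of_forall fun t ht x hx => hC (x, t) ⟨hx, uIoc_subset_uIcc ht⟩
  · refine Eventually.of_forall fun t _ x _ => ?_
    exact (hf.differentiable one_ne_zero (x, t)).hasFDerivAt.comp x (hasFDerivAt_prodMk_left x t)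

theorem ContDiff.parametric_intervalIntegral {E F : Type u} [NormedAddCommGroup E]
    [NormedSpace ℝ E] [ProperSpace E] [NormedAddCommGroup F] [NormedSpace ℝ F]
    {f : E × ℝ → F} (hf : ContDiff ℝ ∞ f) (a b : ℝ) :
    ContDiff ℝ ∞ fun x => ∫ t in a..b, f (x, t) := by
  refine contDiff_infty.2 fun n => ?_
  induction n generalizing F with
  | zero =>
    exact contDiff_zero.2 (continuous_iff_continuousAt.2 fun x =>
      (hasFDerivAt_parametric_intervalIntegral (hf.of_le (by simp)) a b x).continuousAt)
  | succ n ih =>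
    push_cast
    refine contDiff_succ_iff_hasFDerivAt.2 ⟨_,
      ih (f := fun q => (fderiv ℝ f q).comp (ContinuousLinearMap.inl ℝ E ℝ))
        ((hf.fderiv_right (m := ∞) (by simp)).clm_comp contDiff_const),
      fun x => hasFDerivAt_parametric_intervalIntegral (hf.of_le (by simp)) a b x⟩

end ParametricIntegral

/-- Hadamard's lemma: a smooth function vanishing on `E × {0}` is divisible by the last
coordinate, with smooth quotient. -/
theorem ContDiff.exists_eq_smul_of_eq_zero {E F : Type u} [NormedAddCommGroup E]
    [NormedSpace ℝ E] [ProperSpace E] [NormedAddCommGroup F] [NormedSpace ℝ F] [CompleteSpace F]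
    {f : E × ℝ → F} (hf : ContDiff ℝ ∞ f) (h0 : ∀ x, f (x, 0) = 0) :
    ∃ k : E × ℝ → F, ContDiff ℝ ∞ k ∧ ∀ x r, f (x, r) = r • k (x, r) := by
  have hf' : ContDiff ℝ ∞ fun z : (E × ℝ) × ℝ => fderiv ℝ f (z.1.1, z.2 * z.1.2) (0, 1) :=
    ((hf.fderiv_right (m := ∞) (by simp)).comp (by fun_prop)).clm_apply contDiff_const
  refine ⟨_, hf'.parametric_intervalIntegral 0 1, fun x r => ?_⟩
  have hd (t : ℝ) : HasDerivAt (fun t : ℝ => f (x, t * r))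
      (r • fderiv ℝ f (x, t * r) (0, 1)) t := by
    have h₁ : HasDerivAt (fun t : ℝ => (x, t * r)) ((0 : E), r) t := by
      simpa using (hasDerivAt_const t x).prodMk ((hasDerivAt_id t).mul_const r)
    have h₂ := (hf.differentiable (by simp) (x, t * r)).hasFDerivAt.comp_hasDerivAt t h₁
    rwa [← map_smul, Prod.smul_mk, smul_zero, smul_eq_mul, mul_one]
  have hc : Continuous fun t : ℝ => r • fderiv ℝ f (x, t * r) (0, 1) :=
    (hf'.continuous.comp (Continuous.prodMk_right (x, r))).const_smul r
  have h := intervalIntegral.integral_eq_sub_of_hasDerivAt (fun t _ => hd t)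
    (hc.intervalIntegrable 0 1)
  rw [intervalIntegral.integral_smul] at h
  simpa [h0] using h.symm

/-- A smooth function on the closed half-space vanishing on its boundary is divisible by the
last coordinate; the quotient is smooth in the square root of that coordinate. -/
theorem ContDiffOn.exists_sq_eq_sq_mul {E : Type} [NormedAddCommGroup E]
    [NormedSpace ℝ E] [ProperSpace E] {f : E × ℝ → ℝ}
    (hf : ContDiffOn ℝ ∞ f {q | 0 ≤ q.2}) (h0 : ∀ x, f (x, 0) = 0) :
    ∃ k : E × ℝ → ℝ, ContDiff ℝ ∞ k ∧ ∀ x r, f (x, r ^ 2) = r ^ 2 * k (x, r) := by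
  have hF : ContDiff ℝ ∞ fun q : E × ℝ => f (q.1, q.2 ^ 2) := by
    rw [← contDiffOn_univ]
    exact hf.comp (by fun_prop) fun q _ => sq_nonneg q.2
  obtain ⟨k₁, hk₁, hfk₁⟩ := hF.exists_eq_smul_of_eq_zero (by simpa using h0)
  have hodd (x : E) (r : ℝ) (hr : r ∈ ({0}ᶜ : Set ℝ)) : k₁ (x, -r) = -k₁ (x, r) := by
    have h₁ := hfk₁ x r
    have h₂ := hfk₁ x (-r)
    simp only [neg_sq, smul_eq_mul] at h₁ h₂
    exact mul_left_cancel₀ hr (by linarith)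
  have hk₁0 (x : E) : k₁ (x, 0) = 0 := by
    have hc := hk₁.continuous
    have h := congrFun (Continuous.ext_on (dense_compl_singleton (0 : ℝ))
      (f := fun r => k₁ (x, -r)) (g := fun r => -k₁ (x, r)) (by fun_prop) (by fun_prop)
      fun r hr => hodd x r hr) 0
    simp only [neg_zero] at h
    linarith
  obtain ⟨k, hk, hkk⟩ := hk₁.exists_eq_smul_of_eq_zero hk₁0
  refine ⟨k, hk, fun x r => ?_⟩
  have := hfk₁ x r
  simp only [hkk, smul_eq_mul] at this
  rw [this]; ring

/-- Multiplying by a smooth bump function supported in `U` extends smooth functions on the trace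
of `U` on a set `s` to all of `s`. -/
theorem ContDiffBump.contDiffOn_mul {E : Type*} [NormedAddCommGroup E] [NormedSpace ℝ E]
    [FiniteDimensional ℝ E] {c : E} (χ : ContDiffBump c) {U s : Set E}
    (hU : IsOpen U) (hχ : Metric.closedBall c χ.rOut ⊆ U) {f : E → ℝ}
    (hf : ContDiffOn ℝ ∞ f (U ∩ s)) : ContDiffOn ℝ ∞ (fun x => χ x * f x) s := by
  intro x hx
  by_cases hxU : x ∈ U
  · have h : ContDiffWithinAt ℝ ∞ f s x :=
      (hf x ⟨hxU, hx⟩).mono_of_mem_nhdsWithin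
        (inter_mem (mem_nhdsWithin_of_mem_nhds (hU.mem_nhds hxU)) self_mem_nhdsWithin)
    exact χ.contDiff.contDiffWithinAt.mul h
  · have hx' : x ∉ tsupport χ := fun h => hxU (hχ (χ.tsupport_eq ▸ h))
    refine (contDiffWithinAt_const (c := (0 : ℝ))).congr_of_eventuallyEq_of_mem ?_ hx
    filter_upwards [mem_nhdsWithin_of_mem_nhds (notMem_tsupport_iff_eventuallyEq.1 hx')] with y hy
    simp only [Pi.zero_apply] at hy
    rw [hy, zero_mul]

theorem expNegInvGlue_of_pos {y : ℝ} (hy : 0 < y) : expNegInvGlue y = Real.exp (-1 / y) := by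
  rw [expNegInvGlue, if_neg hy.not_ge, neg_div, one_div]

theorem expNegInvGlue_two_mul_sq (y : ℝ) : expNegInvGlue (2 * y) ^ 2 = expNegInvGlue y := by
  rcases le_or_gt y 0 with hy | hy
  · simp [expNegInvGlue.zero_of_nonpos hy,
      expNegInvGlue.zero_of_nonpos (show 2 * y ≤ 0 by linarith)]
  · rw [expNegInvGlue_of_pos hy, expNegInvGlue_of_pos (by positivity), ← Real.exp_nat_mul]
    congr 1
    field_simp
    norm_num

/-- If `f (r ^ 2) = r ^ 2 * k r` near `0` with `k` continuous, then `k 0` is the right derivative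
of `f` at `0`. -/
theorem eq_derivWithin_Ici_of_sq_eq {f k : ℝ → ℝ} (hk : Continuous k) (hf0 : f 0 = 0)
    (hfk : ∀ᶠ r in 𝓝 0, f (r ^ 2) = r ^ 2 * k r)
    (hf : DifferentiableWithinAt ℝ f (Ici 0) 0) : k 0 = derivWithin f (Ici 0) 0 := by
  have hs := hasDerivWithinAt_iff_tendsto_slope.1 hf.hasDerivWithinAt
  have hsq : Tendsto (fun r : ℝ => r ^ 2) (𝓝[≠] 0) (𝓝[Ici 0 \ {0}] 0) := by
    refine tendsto_nhdsWithin_iff.2 ⟨?_, ?_⟩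
    · have : Tendsto (fun r : ℝ => r ^ 2) (𝓝 0) (𝓝 (0 ^ 2)) := (continuous_pow 2).tendsto 0
      simpa using this.mono_left nhdsWithin_le_nhds
    · filter_upwards [self_mem_nhdsWithin] with r hr
      exact ⟨sq_nonneg r, pow_ne_zero 2 hr⟩
  refine tendsto_nhds_unique ((hk.tendsto 0).mono_left nhdsWithin_le_nhds)
    ((hs.comp hsq).congr' ?_)
  filter_upwards [self_mem_nhdsWithin, mem_nhdsWithin_of_mem_nhds hfk] with r hr hr'
  have hr2 : r ≠ 0 := hr
  rw [Function.comp_apply, slope_def_field, hr', hf0]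
  field_simp
  ring

theorem neg_one_div_log_exp_mul {y k : ℝ} (hy : 0 < y) (hk : 0 < k)
    (h : 1 - y * Real.log k ≠ 0) :
    -1 / Real.log (Real.exp (-1 / y) * k) = y / (1 - y * Real.log k) := by
  rw [Real.log_mul (Real.exp_pos _).ne' hk.ne', Real.log_exp]
  have : -1 / y + Real.log k = -(1 - y * Real.log k) / y := by field_simp; ring
  rw [this]
  field_simp

/-- Claim (1) of the main gluing theorem: conjugation by the boundary-crushing
homeomorphism `Φ(x,y) = (x, exp(-1/y))` preserves `C^∞` smoothness at boundary points
of the closed half-space. -/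
theorem stmt0 (d : ℕ) (hd : 1 ≤ d) (p : Fin d → ℝ)
    (g : (Fin d → ℝ) × ℝ → (Fin d → ℝ) × ℝ)
    (U : Set ((Fin d → ℝ) × ℝ)) (hU : IsOpen U) (hpU : (p, (0 : ℝ)) ∈ U)
    (hg : ContDiffOn ℝ (⊤ : ℕ∞) g (U ∩ {q | 0 ≤ q.2}))
    (hbd : ∀ x : Fin d → ℝ, (x, (0 : ℝ)) ∈ U → (g (x, 0)).2 = 0)
    (hmaps : Set.MapsTo g (U ∩ {q | 0 ≤ q.2}) {q | 0 ≤ q.2})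
    (hderiv : 0 < derivWithin (fun y : ℝ => (g (p, y)).2) (Set.Ici 0) 0) :
    ContDiffWithinAt ℝ (⊤ : ℕ∞)
      (fun q : (Fin d → ℝ) × ℝ =>
        if 0 < q.2 then
          ((g (q.1, Real.exp (-1 / q.2))).1,
            -1 / Real.log ((g (q.1, Real.exp (-1 / q.2))).2))
        else ((g (q.1, 0)).1, 0))
      {q | 0 ≤ q.2} (p, 0) := by
  obtain ⟨ε, hε, hεU⟩ := Metric.nhds_basis_closedBall.mem_iff.1 (hU.mem_nhds hpU)
  let χ : ContDiffBump (p, (0 : ℝ)) := ⟨ε / 2, ε, half_pos hε, half_lt_self hε⟩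
  obtain ⟨k, hk, hgk⟩ := (χ.contDiffOn_mul hU hεU hg.snd).exists_sq_eq_sq_mul fun x => by
    by_cases hx : (x, (0 : ℝ)) ∈ U
    · rw [hbd x hx, mul_zero]
    · rw [χ.zero_of_le_dist (not_lt.1 fun h => hx (hεU (Metric.mem_closedBall.2 h.le))), zero_mul]
  have hgk' : ∀ᶠ q : (Fin d → ℝ) × ℝ in 𝓝 (p, 0),
      (g (q.1, q.2 ^ 2)).2 = q.2 ^ 2 * k q := by
    have hc : ContinuousAt (fun q : (Fin d → ℝ) × ℝ => (q.1, q.2 ^ 2)) (p, 0) := by fun_prop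
    have hχ := χ.eventuallyEq_one
    rw [ContinuousAt] at hc
    simp only [ne_eq, OfNat.ofNat_ne_zero, not_false_eq_true, zero_pow] at hc
    filter_upwards [hc.eventually hχ] with q hq
    rw [← hgk, hq, Pi.one_apply, one_mul]
  have hkp : 0 < k (p, 0) := by
    rw [← eq_derivWithin_Ici_of_sq_eq (k := fun r => k (p, r)) (by have := hk.continuous; fun_prop)
      (hbd p hpU) ((Continuous.prodMk_right p).continuousAt.eventually hgk') ?_] at hderiv
    · exact hderiv
    · exact differentiableWithinAt_of_derivWithin_ne_zero hderiv.ne'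
  have he : ContDiff ℝ ∞ expNegInvGlue := expNegInvGlue.contDiff
  set K : (Fin d → ℝ) × ℝ → ℝ := fun q => k (q.1, expNegInvGlue (2 * q.2)) with hK
  have hKs : ContDiff ℝ ∞ K := by fun_prop
  have hK0 : 0 < K (p, 0) := by simpa [hK] using hkp
  have hden : ContDiffAt ℝ ∞ (fun q => 1 - q.2 * Real.log (K q)) (p, (0 : ℝ)) :=
    contDiffAt_const.sub (contDiffAt_snd.mul (hKs.contDiffAt.log hK0.ne'))
  have hden0 : 1 - (p, (0 : ℝ)).2 * Real.log (K (p, 0)) ≠ 0 := by simp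
  have hfst : ContDiffAt ℝ ∞ (fun q : (Fin d → ℝ) × ℝ => (g (q.1, expNegInvGlue q.2)).1)
      (p, 0) := by
    have hΦ : ContDiff ℝ ∞ fun q : (Fin d → ℝ) × ℝ => (q.1, expNegInvGlue q.2) := by fun_prop
    have hmem : (fun q : (Fin d → ℝ) × ℝ => (q.1, expNegInvGlue q.2)) ⁻¹' U ∈ 𝓝 (p, (0 : ℝ)) :=
      hΦ.continuous.continuousAt.preimage_mem_nhds (hU.mem_nhds (by simpa using hpU))
    exact (hg.fst.comp hΦ.contDiffOn fun q hq => ⟨hq, expNegInvGlue.nonneg q.2⟩).contDiffAt hmem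
  refine (hfst.prodMk (contDiffAt_snd.div hden hden0)).contDiffWithinAt.congr_of_eventuallyEq_of_mem
    ?_ (le_refl (0 : ℝ))
  have hc : Tendsto (fun q : (Fin d → ℝ) × ℝ => (q.1, expNegInvGlue (2 * q.2)))
      (𝓝 (p, 0)) (𝓝 (p, 0)) := by
    have : ContinuousAt (fun q : (Fin d → ℝ) × ℝ => (q.1, expNegInvGlue (2 * q.2))) (p, 0) := by
      have := he.continuous
      fun_prop
    simpa [ContinuousAt] using this
  filter_upwards [self_mem_nhdsWithin, mem_nhdsWithin_of_mem_nhds (hc.eventually hgk'),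
    mem_nhdsWithin_of_mem_nhds (hKs.continuous.continuousAt.eventually (lt_mem_nhds hK0)),
    mem_nhdsWithin_of_mem_nhds (hden.continuousAt.eventually_ne hden0)] with q hq hgq hKq hdq
  rcases (show 0 ≤ q.2 from hq).eq_or_lt with h0 | hpos
  · simp [← h0]
  · simp only [expNegInvGlue_two_mul_sq, expNegInvGlue_of_pos hpos] at hgq
    rw [if_pos hpos, hgq, expNegInvGlue_of_pos hpos]
    exact congrArg _ (neg_one_div_log_exp_mul hpos hKq hdq)
end

section
/- Let d ≥ 1, let p ∈ ℝ^d, and let g : ℝ^d × ℝ → ℝ^d × ℝ, written g(x,y) = (g_x(x,y), g_y(x,y)), be C^∞ on U ∩ (ℝ^d × [0,∞)) for some open neighborhood U of (p,0). Assume g_y(x,0) = 0 for all x with (x,0) ∈ U, that g maps U ∩ (ℝ^d × [0,∞)) into ℝ^d × [0,∞), and that ∂g_y/∂y(p,0) > 0. Define Φ²(x,y) = (x, φ(φ(y))) for y > 0 and Φ²(x,0) = (x,0), where φ(y) = exp(−1/y), with inverse (x,s) ↦ (x, ψ(ψ(s))) where ψ(s) = −1/log(s). Let F(x,y) = (Φ²)⁻¹(g(Φ²(x,y)))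 − (g_x(x,0), y). Then for every natural number k, the quotient ‖F(x,y)‖ / ‖(x − p, y)‖^k tends to 0 as (x,y) → (p,0) within ℝ^d × [0,∞). -/
open Filter Topology in
theorem tendsto_exp_neg_one_div_nhdsGT_zero :
    Tendsto (fun y : ℝ => Real.exp (-1 / y)) (𝓝[>] 0) (𝓝[>] 0) := by
  refine tendsto_nhdsWithin_iff.2 ⟨?_, Eventually.of_forall fun y => Real.exp_pos _⟩
  refine Real.tendsto_exp_atBot.comp ?_
  refine (tendsto_neg_atTop_atBot.comp tendsto_inv_nhdsGT_zero).congr fun y => ?_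
  simp [neg_div]

open Filter Topology in
/-- `exp (-1 / y)` vanishes to infinite order at `0` from the right. -/
theorem tendsto_exp_neg_one_div_div_pow (k : ℕ) :
    Tendsto (fun y : ℝ => Real.exp (-1 / y) / y ^ k) (𝓝[>] 0) (𝓝 0) := by
  refine ((Real.tendsto_pow_mul_exp_neg_atTop_nhds_zero k).comp
    tendsto_inv_nhdsGT_zero).congr fun y => ?_
  simp only [Function.comp_apply, inv_pow, neg_div, one_div]
  rw [mul_comm, div_eq_mul_inv]

theorem abs_log_one_sub_le {x : ℝ} (hx : |x| ≤ 1 / 2) : |Real.log (1 - x)| ≤ 2 * |x| := by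
  have hx' := abs_le.1 hx
  have hpos : 0 < 1 - x := by linarith
  have hupper := Real.log_le_sub_one_of_pos hpos
  have hlower := Real.one_sub_inv_le_log_of_pos hpos
  have hinv : (1 - x)⁻¹ ≤ 1 + 2 * |x| := by
    rw [inv_le_comm₀ hpos (by positivity), inv_le_iff_one_le_mul₀ (by positivity)]
    rcases abs_cases x with ⟨h, _⟩ | ⟨h, _⟩ <;> rw [h] <;> nlinarith
  rw [abs_le]
  constructor
  · linarith
  · linarith [neg_abs_le x, abs_nonneg x]

/-- Changing `exp (-1 / exp (-1 / y))` by a factor of bounded logarithm changes the result of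
applying `s ↦ -1 / log s` twice by at most a multiple of `exp (-1 / y)`. -/
theorem abs_neg_one_div_log_neg_one_div_log_sub_le {M y w : ℝ} (hy : 0 < y) (hy' : y ≤ 1 / 2)
    (hMy : M * Real.exp (-1 / y) ≤ 1 / 2)
    (hw : |Real.log w - -1 / Real.exp (-1 / y)| ≤ M) :
    |-1 / Real.log (-1 / Real.log w) - y| ≤ M * Real.exp (-1 / y) := by
  set e := Real.exp (-1 / y) with he
  have hepos : 0 < e := Real.exp_pos _
  set c := Real.log w - -1 / e with hc
  have hce : |c * e| ≤ M * e := by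
    rw [abs_mul, abs_of_pos hepos]
    gcongr
  have hce' := abs_le.1 (hce.trans hMy)
  have hl := abs_log_one_sub_le (hce.trans hMy)
  have hpos : 0 < 1 - c * e := by linarith
  have hψ : -1 / Real.log w = e / (1 - c * e) := by
    have : Real.log w = -(1 - c * e) / e := by
      rw [hc]; field_simp; ring
    rw [this]
    field_simp
  rw [hψ, Real.log_div hepos.ne' hpos.ne', he, Real.log_exp, ← he]
  set l := Real.log (1 - c * e)
  have hl1 : |l| ≤ 2 * (M * e) := hl.trans (by linarith)
  have hl' := abs_le.1 hl1
  have hden : 1 / 2 ≤ 1 + y * l := by nlinarith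
  have hden0 : 0 < 1 + y * l := by linarith
  have heq : -1 / (-1 / y - l) - y = -(y ^ 2 * l) / (1 + y * l) := by
    have h1 : -1 / y - l = -(1 + y * l) / y := by field_simp; ring
    rw [h1]
    field_simp
    ring
  rw [heq, abs_div, abs_neg, abs_mul, abs_of_pos hden0, abs_of_nonneg (sq_nonneg y),
    div_le_iff₀ hden0]
  have hy2 : y ^ 2 ≤ 1 / 4 := by nlinarith
  have hMe : 0 ≤ M * e := (abs_nonneg _).trans hce
  calc y ^ 2 * |l| ≤ 1 / 4 * (2 * (M * e)) := by gcongr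
    _ ≤ M * e * (1 + y * l) := by nlinarith

open Filter Topology in
/-- A first order expansion of `g` in the last variable, uniform in the first one. -/
theorem eventually_norm_sub_smul_le {E G : Type*} [NormedAddCommGroup E] [NormedSpace ℝ E]
    [NormedAddCommGroup G] [NormedSpace ℝ G] {g : E × ℝ → G} {p : E} {U : Set (E × ℝ)}
    (hU : IsOpen U) (hpU : (p, (0 : ℝ)) ∈ U) (hg : ContDiffOn ℝ 1 g (U ∩ {q | 0 ≤ q.2}))
    {ε : ℝ} (hε : 0 < ε) :
    ∀ᶠ q in 𝓝[{q : E × ℝ | 0 ≤ q.2}] (p, 0),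
      ‖g q - g (q.1, 0) - q.2 • derivWithin (fun y : ℝ => g (p, y)) (Set.Ici 0) 0‖ ≤ ε * q.2 := by
  set S : Set (E × ℝ) := U ∩ {q | 0 ≤ q.2} with hS
  have hpS : (p, (0 : ℝ)) ∈ S := ⟨hpU, le_refl (0 : ℝ)⟩
  have hhalf : {q : E × ℝ | 0 ≤ q.2} = Set.univ ×ˢ Set.Ici (0 : ℝ) := by ext; simp
  have hSu : UniqueDiffOn ℝ S := by
    rw [hS, Set.inter_comm, hhalf]
    exact (uniqueDiffOn_univ.prod (uniqueDiffOn_Ici 0)).inter hU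
  have hdiff := hg.differentiableOn one_ne_zero
  have hcont := hg.continuousOn_fderivWithin hSu le_rfl
  set L := fderivWithin ℝ g S (p, 0)
  have hL : HasFDerivWithinAt g L {q | 0 ≤ q.2} (p, 0) :=
    (hasFDerivWithinAt_inter' (mem_nhdsWithin_of_mem_nhds (hU.mem_nhds hpU))).1
      (by rw [Set.inter_comm]; exact (hdiff _ hpS).hasFDerivWithinAt)
  have hv : derivWithin (fun y : ℝ => g (p, y)) (Set.Ici 0) 0 = L (0, 1) := by
    have hline : HasDerivWithinAt (fun y : ℝ => (p, y)) ((0 : E), (1 : ℝ)) (Set.Ici 0) 0 :=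
      (hasDerivWithinAt_const _ _ _).prodMk (hasDerivWithinAt_id _ _)
    exact (hL.comp_hasDerivWithinAt 0 hline fun y hy => hy).derivWithin
      (uniqueDiffOn_Ici (0 : ℝ) 0 Set.self_mem_Ici)
  have hnear : ∀ᶠ q in 𝓝[S] (p, (0 : ℝ)), ‖fderivWithin ℝ g S q - L‖ < ε := by
    have := (hcont _ hpS).eventually (Metric.ball_mem_nhds _ hε)
    filter_upwards [this] with q hq
    rwa [← dist_eq_norm]
  obtain ⟨δ, hδ, hball⟩ := Metric.eventually_nhds_iff_ball.1
    ((eventually_nhdsWithin_iff.1 hnear).and (hU.eventually_mem hpU))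
  set s := Metric.ball (p, (0 : ℝ)) δ ∩ {q : E × ℝ | 0 ≤ q.2} with hs
  have hsS : s ⊆ S := fun q hq => ⟨(hball q hq.1).2, hq.2⟩
  have hsconv : Convex ℝ s := by
    rw [hs, hhalf]
    exact (convex_ball _ _).inter (convex_univ.prod (convex_Ici 0))
  filter_upwards [inter_mem_nhdsWithin _ (Metric.ball_mem_nhds (p, (0 : ℝ)) hδ)] with q hq
  have hqs : q ∈ s := ⟨hq.2, hq.1⟩
  have hq2 : 0 ≤ q.2 := hq.1
  have hq0 : (q.1, (0 : ℝ)) ∈ s := by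
    refine ⟨?_, le_refl (0 : ℝ)⟩
    have h := hq.2
    simp only [Metric.mem_ball, Prod.dist_eq, max_lt_iff, dist_self] at h ⊢
    exact ⟨h.1, hδ⟩
  have key := hsconv.norm_image_sub_le_of_norm_hasFDerivWithin_le' (f := g)
    (fun z hz => ((hdiff z (hsS hz)).hasFDerivWithinAt).mono hsS)
    (fun z hz => ((hball z hz.1).1 (hsS hz)).le) hq0 hqs
  have hsub : q - (q.1, (0 : ℝ)) = q.2 • ((0 : E), (1 : ℝ)) := by ext <;> simp
  rw [hsub, map_smul, ← hv] at key
  simpa [norm_smul, abs_of_nonneg hq2, Prod.norm_def, max_eq_right hq2] using key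

theorem exp_neg_one_div_le_self {y : ℝ} (hy : 0 < y) : Real.exp (-1 / y) ≤ y := by
  rw [neg_div, Real.exp_neg, inv_le_comm₀ (Real.exp_pos _) hy, ← one_div]
  linarith [Real.add_one_le_exp (1 / y)]

theorem abs_log_sub_log_le {a t w : ℝ} (ha : 0 < a) (ht : 0 < t)
    (hw : |w - t * a| ≤ a / 2 * t) :
    |Real.log w - Real.log t| ≤ |Real.log (a / 2)| + |Real.log (3 * a / 2)| := by
  obtain ⟨h1, h2⟩ := abs_le.1 hw
  have hlow : a / 2 * t ≤ w := by linarith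
  have hupp : w ≤ 3 * a / 2 * t := by linarith
  have hw0 : 0 < w := lt_of_lt_of_le (by positivity) hlow
  have hl := Real.log_le_log (by positivity) hlow
  have hu := Real.log_le_log hw0 hupp
  rw [Real.log_mul (by positivity) ht.ne'] at hl hu
  refine abs_le.2 ⟨?_, ?_⟩
  · linarith [neg_abs_le (Real.log (a / 2)), abs_nonneg (Real.log (3 * a / 2))]
  · linarith [le_abs_self (Real.log (3 * a / 2)), abs_nonneg (Real.log (a / 2))]


/-- Quantitative content of Claim (2) of the main gluing theorem: after conjugation by
`Φ² (x,y) = (x, φ(φ(y)))` with `φ(y) = exp(-1/y)` (inverse `ψ(s) = -1/log s`), the map `g`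
differs from `(x,y) ↦ (g_x(x,0), y)` by an error decaying faster than any polynomial
at the boundary point `(p,0)`. -/
theorem stmt1 (d : ℕ) (hd : 1 ≤ d) (p : Fin d → ℝ)
    (g : (Fin d → ℝ) × ℝ → (Fin d → ℝ) × ℝ)
    (U : Set ((Fin d → ℝ) × ℝ)) (hU : IsOpen U) (hpU : (p, (0 : ℝ)) ∈ U)
    (hg : ContDiffOn ℝ (⊤ : ℕ∞) g (U ∩ {q | 0 ≤ q.2}))
    (hbd : ∀ x : Fin d → ℝ, (x, (0 : ℝ)) ∈ U → (g (x, 0)).2 = 0)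
    (hmaps : Set.MapsTo g (U ∩ {q | 0 ≤ q.2}) {q | 0 ≤ q.2})
    (hderiv : 0 < derivWithin (fun y : ℝ => (g (p, y)).2) (Set.Ici 0) 0)
    (φ ψ : ℝ → ℝ) (hφ : ∀ y, φ y = Real.exp (-1 / y)) (hψ : ∀ s, ψ s = -1 / Real.log s)
    (F : (Fin d → ℝ) × ℝ → (Fin d → ℝ) × ℝ)
    (hF : ∀ q : (Fin d → ℝ) × ℝ,
      F q = (if 0 < q.2 then
              ((g (q.1, φ (φ q.2))).1, ψ (ψ ((g (q.1, φ (φ q.2))).2)))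
            else ((g (q.1, 0)).1, 0)) - ((g (q.1, 0)).1, q.2)) :
    ∀ k : ℕ,
      Filter.Tendsto (fun q : (Fin d → ℝ) × ℝ => ‖F q‖ / ‖q - (p, 0)‖ ^ k)
        (nhdsWithin (p, (0 : ℝ)) {q | 0 ≤ q.2}) (nhds 0) := by
  intro k
  obtain rfl : φ = fun y => Real.exp (-1 / y) := funext hφ
  obtain rfl : ψ = fun s => -1 / Real.log s := funext hψ
  have hsplit : {q : (Fin d → ℝ) × ℝ | 0 ≤ q.2} = {q | 0 < q.2} ∪ {q | q.2 = 0} := by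
    ext q
    simp [le_iff_lt_or_eq, eq_comm]
  rw [hsplit, nhdsWithin_union, Filter.tendsto_sup]
  refine ⟨?_, tendsto_const_nhds.congr' ?_⟩
  swap
  · filter_upwards [self_mem_nhdsWithin] with q hq
    have hq0 : q.2 = 0 := hq
    rw [hF, if_neg hq0.not_gt, hq0]
    simp
  have hg1 : ContDiffOn ℝ 1 g (U ∩ {q | 0 ≤ q.2}) := hg.of_le (by exact_mod_cast le_top)
  set a := derivWithin (fun y : ℝ => (g (p, y)).2) (Set.Ici 0) 0
  set M := |Real.log (a / 2)| + |Real.log (3 * a / 2)|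
  set v := derivWithin (fun y : ℝ => (g (p, y)).1) (Set.Ici 0) 0
  have hfst := eventually_norm_sub_smul_le hU hpU hg1.fst one_pos
  have hsnd := eventually_norm_sub_smul_le hU hpU hg1.snd (half_pos hderiv)
  have hy : Filter.Tendsto (fun q : (Fin d → ℝ) × ℝ => q.2)
      (nhdsWithin (p, 0) {q | 0 < q.2}) (nhdsWithin 0 (Set.Ioi 0)) :=
    tendsto_nhdsWithin_iff.2 ⟨(continuous_snd.tendsto' _ _ rfl).mono_left nhdsWithin_le_nhds,
      self_mem_nhdsWithin⟩
  have hx : Filter.Tendsto (fun q : (Fin d → ℝ) × ℝ => q.1)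
      (nhdsWithin (p, 0) {q | 0 < q.2}) (nhds p) :=
    (continuous_fst.tendsto' _ _ rfl).mono_left nhdsWithin_le_nhds
  have hφy := tendsto_exp_neg_one_div_nhdsGT_zero.comp hy
  have hφφy := tendsto_nhdsWithin_iff.1 (tendsto_exp_neg_one_div_nhdsGT_zero.comp hφy)
  have hΦ : Filter.Tendsto
      (fun q : (Fin d → ℝ) × ℝ => (q.1, Real.exp (-1 / Real.exp (-1 / q.2))))
      (nhdsWithin (p, 0) {q | 0 < q.2}) (nhdsWithin (p, 0) {q | 0 ≤ q.2}) :=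
    tendsto_nhdsWithin_iff.2 ⟨hx.prodMk_nhds hφφy.1,
      Filter.Eventually.of_forall fun q => (Real.exp_pos _).le⟩
  have hU0 : ∀ᶠ q : (Fin d → ℝ) × ℝ in nhdsWithin (p, 0) {q | 0 < q.2}, (q.1, (0 : ℝ)) ∈ U :=
    (hx.prodMk_nhds tendsto_const_nhds).eventually_mem (hU.mem_nhds hpU)
  have hsmall : ∀ᶠ q : (Fin d → ℝ) × ℝ in nhdsWithin (p, 0) {q | 0 < q.2},
      M * Real.exp (-1 / q.2) ≤ 1 / 2 := by
    have h : Filter.Tendsto (fun q : (Fin d → ℝ) × ℝ => M * Real.exp (-1 / q.2))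
        (nhdsWithin (p, 0) {q | 0 < q.2}) (nhds 0) := by
      simpa using (tendsto_nhdsWithin_iff.1 hφy).1.const_mul M
    exact h.eventually_le_const (by norm_num)
  have hhalf : ∀ᶠ q : (Fin d → ℝ) × ℝ in nhdsWithin (p, 0) {q | 0 < q.2}, q.2 ≤ 1 / 2 :=
    (tendsto_nhdsWithin_iff.1 hy).1.eventually_le_const (by norm_num)
  have hlim : Filter.Tendsto
      (fun q : (Fin d → ℝ) × ℝ => (1 + ‖v‖ + M) * (Real.exp (-1 / q.2) / q.2 ^ k))
      (nhdsWithin (p, 0) {q | 0 < q.2}) (nhds 0) := by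
    simpa using ((tendsto_exp_neg_one_div_div_pow k).comp hy).const_mul (1 + ‖v‖ + M)
  refine squeeze_zero' (Filter.Eventually.of_forall fun q => by positivity) ?_ hlim
  filter_upwards [self_mem_nhdsWithin, hΦ.eventually hfst, hΦ.eventually hsnd, hU0, hsmall,
    hhalf] with q hq hq1 hq2 hqU hqM hqhalf
  have hqpos : 0 < q.2 := hq
  set e := Real.exp (-1 / q.2) with he
  set t := Real.exp (-1 / e) with ht
  have hepos : 0 < e := Real.exp_pos _
  have htpos : 0 < t := Real.exp_pos _
  have hte : t ≤ e := exp_neg_one_div_le_self hepos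
  have hMnonneg : 0 ≤ M := by positivity
  simp only [hbd _ hqU, sub_zero, Real.norm_eq_abs, smul_eq_mul] at hq2
  have hlog := abs_log_sub_log_le hderiv htpos hq2
  rw [ht, Real.log_exp, ← ht] at hlog
  have hbound2 := abs_neg_one_div_log_neg_one_div_log_sub_le hqpos hqhalf hqM hlog
  have hbound1 : ‖(g (q.1, t)).1 - (g (q.1, 0)).1‖ ≤ (1 + ‖v‖) * e := by
    have h := norm_le_norm_sub_add ((g (q.1, t)).1 - (g (q.1, 0)).1) (t • v)
    rw [norm_smul, Real.norm_of_nonneg htpos.le] at h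
    calc _ ≤ 1 * t + t * ‖v‖ := h.trans (by gcongr)
      _ = (1 + ‖v‖) * t := by ring
      _ ≤ (1 + ‖v‖) * e := by gcongr
  have hFq : ‖F q‖ ≤ (1 + ‖v‖ + M) * e := by
    rw [hF, if_pos hqpos, Prod.norm_def]
    exact max_le
      (hbound1.trans (mul_le_mul_of_nonneg_right (by linarith) hepos.le))
      (hbound2.trans (mul_le_mul_of_nonneg_right (by linarith [norm_nonneg v]) hepos.le))
  have hnorm : q.2 ≤ ‖q - (p, 0)‖ := by
    have h := norm_snd_le (q - (p, 0))
    rw [Prod.snd_sub, sub_zero, Real.norm_of_nonneg hqpos.le] at h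
    exact h
  rw [← mul_div_assoc]
  gcongr
end

section
/- Let n, m ≥ 1 and let G : ℝ^n → ℝ^m be C^∞ on a neighborhood of 0. Suppose that for every natural number k, ‖G(x)‖ / ‖x‖^k tends to 0 as x → 0 (x ≠ 0). Then for every natural number k, the k-th iterated derivative of G at 0 is zero. -/
open Filter Topology Asymptotics in
/-- If a function is `C²` at `0` and vanishes there to every polynomial order, then so does its
derivative. -/
theorem ContDiffAt.fderiv_isBigO_norm_pow {E F : Type*} [NormedAddCommGroup E] [NormedSpace ℝ E]
    [NormedAddCommGroup F] [NormedSpace ℝ F] {f : E → F} (hf : ContDiffAt ℝ 2 f 0)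
    (hflat : ∀ k : ℕ, f =O[𝓝 0] fun x => ‖x‖ ^ k) (k : ℕ) :
    fderiv ℝ f =O[𝓝 0] fun x => ‖x‖ ^ k := by
  -- it suffices to treat positive exponents
  suffices H : ∀ k : ℕ, 1 ≤ k → fderiv ℝ f =O[𝓝 0] fun x => ‖x‖ ^ k by
    refine (H (k + 1) (by omega)).trans (IsBigO.of_bound 1 ?_)
    filter_upwards [Metric.ball_mem_nhds (0 : E) one_pos] with x hx
    have hx1 : ‖x‖ ≤ 1 := by simpa using (mem_ball_zero_iff.1 hx).le
    simp only [norm_pow, norm_norm, one_mul]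
    exact pow_le_pow_of_le_one (norm_nonneg _) hx1 (by omega)
  intro k hk
  have h0 : fderiv ℝ f 0 = 0 :=
    (IsBigO.hasFDerivAt (n := 2) (by simpa using hflat 2) (by norm_num)).fderiv
  obtain ⟨K, s, hs, hK⟩ :=
    (hf.fderiv_right (m := 1) (by norm_num)).exists_lipschitzOnWith
  obtain ⟨c, hc⟩ := (hflat (2 * k)).bound
  have hd : ∀ᶠ x in 𝓝 (0 : E), DifferentiableAt ℝ f x :=
    (hf.eventually (by simp)).mono fun x hx => hx.differentiableAt (by norm_num)
  obtain ⟨δ, hδ, hball⟩ := Metric.eventually_nhds_iff_ball.1 ((hd.and hc).and hs)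
  refine IsBigO.of_bound (|c| * 2 ^ (2 * k) + |c| + K) ?_
  filter_upwards [Metric.ball_mem_nhds (0 : E) (show 0 < min 1 (δ / 2) by positivity)] with x hx
  rw [mem_ball_zero_iff, lt_min_iff] at hx
  obtain ⟨hx1, hxδ⟩ := hx
  rcases eq_or_ne x 0 with rfl | hx0
  · rw [h0, norm_zero]; positivity
  have hxpos : 0 < ‖x‖ := norm_pos_iff.2 hx0
  set t := ‖x‖ ^ k with ht
  have htpos : 0 < t := by positivity
  have htx : t ≤ ‖x‖ := pow_le_of_le_one hxpos.le hx1.le (by omega)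
  have hsub : ∀ y ∈ Metric.closedBall x t, y ∈ Metric.ball (0 : E) δ := fun y hy => by
    rw [mem_closedBall_iff_norm] at hy
    rw [mem_ball_zero_iff]
    linarith [norm_le_norm_add_norm_sub' y x]
  have hxt : x ∈ Metric.closedBall x t := Metric.mem_closedBall_self htpos.le
  rw [Real.norm_of_nonneg htpos.le]
  refine ContinuousLinearMap.opNorm_le_of_unit_norm (by positivity) fun v hv => ?_
  have hnorm : ‖t • v‖ = t := by rw [norm_smul, hv, mul_one, Real.norm_of_nonneg htpos.le]
  have hyt : x + t • v ∈ Metric.closedBall x t := by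
    rw [mem_closedBall_iff_norm, add_sub_cancel_left, hnorm]
  have key := Convex.norm_image_sub_le_of_norm_fderiv_le' (𝕜 := ℝ) (f := f) (C := K * t)
    (φ := fderiv ℝ f x) (fun y hy => (hball y (hsub y hy)).1.1)
    (fun y hy => by
      refine (hK.norm_sub_le (hball y (hsub y hy)).2 (hball x (hsub x hxt)).2).trans ?_
      exact mul_le_mul_of_nonneg_left (mem_closedBall_iff_norm.1 hy) K.2)
    (convex_closedBall x t) hxt hyt
  rw [add_sub_cancel_left, hnorm, map_smul] at key
  have hfx : ‖f x‖ ≤ |c| * t ^ 2 := by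
    refine (hball x (hsub x hxt)).1.2.trans ?_
    rw [norm_pow, norm_norm, pow_mul', ← ht]
    gcongr
    exact le_abs_self c
  have hfy : ‖f (x + t • v)‖ ≤ |c| * 2 ^ (2 * k) * t ^ 2 := by
    refine (hball _ (hsub _ hyt)).1.2.trans ?_
    have hle : ‖x + t • v‖ ≤ 2 * ‖x‖ := by linarith [norm_add_le x (t • v)]
    calc c * ‖‖x + t • v‖ ^ (2 * k)‖ ≤ |c| * (2 * ‖x‖) ^ (2 * k) := by
          rw [norm_pow, norm_norm]
          gcongr
          exact le_abs_self c
      _ = |c| * 2 ^ (2 * k) * t ^ 2 := by rw [mul_pow, ht]; ring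
  have hmul : t * ‖fderiv ℝ f x v‖ ≤ t * ((|c| * 2 ^ (2 * k) + |c| + K) * t) := by
    calc t * ‖fderiv ℝ f x v‖ = ‖t • fderiv ℝ f x v‖ := by
          rw [norm_smul, Real.norm_of_nonneg htpos.le]
      _ ≤ ‖f (x + t • v) - f x‖ + ‖f (x + t • v) - f x - t • fderiv ℝ f x v‖ := by
          simpa using norm_sub_le (f (x + t • v) - f x)
            (f (x + t • v) - f x - t • fderiv ℝ f x v)
      _ ≤ (|c| * 2 ^ (2 * k) * t ^ 2 + |c| * t ^ 2) + K * t * t := by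
          gcongr
          exact (norm_sub_le _ _).trans (add_le_add hfy hfx)
      _ = t * ((|c| * 2 ^ (2 * k) + |c| + K) * t) := by ring
  exact le_of_mul_le_mul_left hmul htpos

open Filter Topology Asymptotics in
/-- If a function is smooth at `0` and vanishes there to every polynomial order, then so do all of
its iterated derivatives. -/
theorem ContDiffAt.iteratedFDeriv_isBigO_norm_pow {E F : Type*} [NormedAddCommGroup E]
    [NormedSpace ℝ E] [NormedAddCommGroup F] [NormedSpace ℝ F] {f : E → F}
    (hf : ContDiffAt ℝ (⊤ : ℕ∞) f 0) (hflat : ∀ k : ℕ, f =O[𝓝 0] fun x => ‖x‖ ^ k) (j k : ℕ) :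
    iteratedFDeriv ℝ j f =O[𝓝 0] fun x => ‖x‖ ^ k := by
  induction j generalizing k with
  | zero =>
    refine IsBigO.of_norm_left ?_
    simpa only [norm_iteratedFDeriv_zero] using (hflat k).norm_left
  | succ j ih =>
    have hj : ContDiffAt ℝ 2 (iteratedFDeriv ℝ j f) 0 :=
      hf.iteratedFDeriv_right (WithTop.coe_le_coe.2 (le_top (a := (2 + j : ℕ∞))))
    refine IsBigO.of_norm_left ?_
    simpa only [norm_fderiv_iteratedFDeriv] using (hj.fderiv_isBigO_norm_pow ih k).norm_left


/-- Converse-Taylor fact: if `G` is `C^∞` near `0` and `‖G(x)‖/‖x‖^k → 0` as `x → 0` for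
every `k`, then all iterated derivatives of `G` at `0` vanish. -/
theorem stmt7 (n m : ℕ) (hn : 1 ≤ n) (hm : 1 ≤ m)
    (G : EuclideanSpace ℝ (Fin n) → EuclideanSpace ℝ (Fin m))
    (V : Set (EuclideanSpace ℝ (Fin n))) (hV : V ∈ nhds (0 : EuclideanSpace ℝ (Fin n)))
    (hG : ContDiffOn ℝ (⊤ : ℕ∞) G V)
    (hdecay : ∀ k : ℕ,
      Filter.Tendsto (fun x : EuclideanSpace ℝ (Fin n) => ‖G x‖ / ‖x‖ ^ k)
        (nhdsWithin 0 {x | x ≠ 0}) (nhds 0)) :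
    ∀ k : ℕ, iteratedFDeriv ℝ k G 0 = 0 := by
  have hGat : ContDiffAt ℝ (⊤ : ℕ∞) G 0 := hG.contDiffAt hV
  have : Nonempty (Fin n) := ⟨⟨0, hn⟩⟩
  have hG0 : G 0 = 0 := by
    have h1 : Filter.Tendsto (fun x => ‖G x‖) (nhdsWithin 0 {x | x ≠ 0}) (nhds 0) := by
      simpa using hdecay 0
    have h2 : Filter.Tendsto (fun x => ‖G x‖) (nhdsWithin 0 {x | x ≠ 0}) (nhds ‖G 0‖) :=
      hGat.continuousAt.norm.tendsto.mono_left nhdsWithin_le_nhds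
    have : (nhdsWithin (0 : EuclideanSpace ℝ (Fin n)) {x | x ≠ 0}).NeBot :=
      Module.punctured_nhds_neBot ℝ (EuclideanSpace ℝ (Fin n)) 0
    exact norm_eq_zero.1 (tendsto_nhds_unique h2 h1)
  have hflat : ∀ k : ℕ, G =O[nhds 0] fun x => ‖x‖ ^ k := fun k => by
    refine Asymptotics.IsBigO.of_bound 1 ?_
    have h := (hdecay k).eventually_le_const one_pos
    rw [eventually_nhdsWithin_iff] at h
    filter_upwards [h] with x hx
    rcases eq_or_ne x 0 with rfl | hx0
    · rw [hG0, norm_zero]; positivity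
    · have hpos : 0 < ‖x‖ ^ k := pow_pos (norm_pos_iff.2 hx0) k
      rw [norm_pow, norm_norm]
      exact (div_le_iff₀ hpos).1 (hx hx0)
  intro k
  have hb := (hGat.iteratedFDeriv_isBigO_norm_pow hflat k 1).eq_zero_imp.self_of_nhds
  exact hb (by simp)
end

section
/- Let n ≥ 1 and let f : EuclideanSpace ℝ (Fin n) → EuclideanSpace ℝ (Fin n) be C¹ at 0 with f(0) = 0, and suppose the derivative A = fderiv ℝ f 0 is invertible (a continuous linear equivalence). Then for every unit vector θ (‖θ‖ = 1), as r → 0 from the right: ‖f(r • θ)‖ → 0 and ‖f(r • θ)‖⁻¹ • f(r • θ) → ‖A θ‖⁻¹ • A θ. -/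
/-- A curve leaving the origin with nonzero velocity `v` has limiting direction `v / ‖v‖`. -/
theorem HasDerivAt.tendsto_inv_norm_smul_nhdsGT {E : Type*} [NormedAddCommGroup E]
    [NormedSpace ℝ E] {g : ℝ → E} {v : E} (hg : HasDerivAt g v 0) (hg0 : g 0 = 0) (hv : v ≠ 0) :
    Filter.Tendsto (fun r : ℝ => ‖g r‖⁻¹ • g r) (nhdsWithin 0 (Set.Ioi 0))
      (nhds (‖v‖⁻¹ • v)) := by
  have hslope := hg.tendsto_slope_zero_right
  simp only [zero_add, hg0, sub_zero] at hslope
  refine ((hslope.norm.inv₀ (norm_ne_zero_iff.mpr hv)).smul hslope).congr' ?_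
  filter_upwards [self_mem_nhdsWithin] with r hr
  have hr : 0 < r := hr
  rw [norm_smul, norm_inv, Real.norm_of_nonneg hr.le, smul_smul]
  congr 1
  field_simp

/-- Boundary behavior underlying the blow-up construction: if `f` is `C¹` at `0`, fixes `0`,
and has invertible derivative `A` there, then for every unit vector `θ`, as `r → 0⁺`,
`‖f(r • θ)‖ → 0` and `f(r • θ)/‖f(r • θ)‖ → A θ / ‖A θ‖`. -/
theorem stmt9 (n : ℕ) (hn : 1 ≤ n)
    (f : EuclideanSpace ℝ (Fin n) → EuclideanSpace ℝ (Fin n))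
    (hf : ContDiffAt ℝ 1 f 0) (hf0 : f 0 = 0)
    (A : EuclideanSpace ℝ (Fin n) ≃L[ℝ] EuclideanSpace ℝ (Fin n))
    (hA : (A : EuclideanSpace ℝ (Fin n) →L[ℝ] EuclideanSpace ℝ (Fin n)) = fderiv ℝ f 0)
    (θ : EuclideanSpace ℝ (Fin n)) (hθ : ‖θ‖ = 1) :
    Filter.Tendsto (fun r : ℝ => ‖f (r • θ)‖) (nhdsWithin 0 (Set.Ioi 0)) (nhds 0) ∧
    Filter.Tendsto (fun r : ℝ => ‖f (r • θ)‖⁻¹ • f (r • θ)) (nhdsWithin 0 (Set.Ioi 0))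
      (nhds (‖A θ‖⁻¹ • A θ)) := by
  have hderiv : HasDerivAt (fun r : ℝ => f (r • θ)) (A θ) 0 := by
    have hA' : HasFDerivAt f (A : EuclideanSpace ℝ (Fin n) →L[ℝ] EuclideanSpace ℝ (Fin n))
        ((0 : ℝ) • θ) := by
      rw [hA, zero_smul]
      exact (hf.differentiableAt one_ne_zero).hasFDerivAt
    simpa [Function.comp_def] using
      hA'.comp_hasDerivAt (0 : ℝ) ((hasDerivAt_id (0 : ℝ)).smul_const θ)
  have hAθ : A θ ≠ 0 := by
    rw [Ne, A.map_eq_zero_iff, ← norm_eq_zero, hθ]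
    exact one_ne_zero
  refine ⟨?_, hderiv.tendsto_inv_norm_smul_nhdsGT (by simpa using hf0) hAθ⟩
  have hcont := hderiv.continuousAt.norm.tendsto
  simp only [zero_smul, hf0, norm_zero] at hcont
  exact hcont.mono_left nhdsWithin_le_nhds
end

section
/- Let G be a group generated by two elements f and g (i.e., the subgroup closure of {f, g} is all of G). Let h := f·g·f⁻¹·g⁻¹, and suppose h·f = f·h, h·g = g·h, and h has infinite order (hⁿ ≠ 1 for all integers n ≠ 0). Then G is isomorphic to the discrete Heisenberg group, i.e., to the subgroup of the units of the 3×3 integer matrix ring generated by the matrix X with rows (1,1,0),(0,1,0),(0,0,1) and the matrix Y with rows (1,0,0),(0,1,1),(0,0,1). -/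
/-- The normal form `g ^ b * f ^ a * h ^ c` of an element of a Heisenberg-type group. -/
def heisenbergWord {G : Type*} [Group G] (f g h : G) (p : ℤ × ℤ × ℤ) : G :=
  g ^ p.2.1 * f ^ p.1 * h ^ p.2.2

section HeisenbergWord

variable {G : Type*} [Group G] {f g h : G}

theorem zpow_mul_zpow_of_central_commutator (hfg : f * g = h * g * f)
    (hhf : Commute h f) (hhg : Commute h g) (a b : ℤ) :
    f ^ a * g ^ b = g ^ b * f ^ a * h ^ (a * b) := by
  have hf : SemiconjBy f (g ^ b) ((h * g) ^ b) := SemiconjBy.zpow_right hfg b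
  have hg : SemiconjBy (g ^ b) (f * h ^ b) f := by
    have hf' : f * g ^ b = h ^ b * g ^ b * f := by rw [← hhg.mul_zpow]; exact hf
    change g ^ b * (f * h ^ b) = f * g ^ b
    rw [hf', ← (hhf.zpow_left b).eq, ← mul_assoc, (hhg.zpow_zpow b b).eq]
  have hga := (hg.zpow_right a).eq
  rw [(hhf.zpow_left b).symm.mul_zpow, ← zpow_mul, mul_comm b a, ← mul_assoc] at hga
  exact hga.symm

theorem heisenbergWord_mul (hfg : f * g = h * g * f)
    (hhf : Commute h f) (hhg : Commute h g) (p q : ℤ × ℤ × ℤ) :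
    heisenbergWord f g h p * heisenbergWord f g h q =
      heisenbergWord f g h
        (p.1 + q.1, p.2.1 + q.2.1, p.2.2 + q.2.2 + p.1 * q.2.1) := by
  obtain ⟨a, b, c⟩ := p
  obtain ⟨a', b', c'⟩ := q
  simp only [heisenbergWord]
  calc g ^ b * f ^ a * h ^ c * (g ^ b' * f ^ a' * h ^ c')
      = g ^ b * f ^ a * (h ^ c * (g ^ b' * f ^ a')) * h ^ c' := by group
    _ = g ^ b * (f ^ a * g ^ b') * f ^ a' * h ^ c * h ^ c' := by
      rw [((hhg.zpow_zpow c b').mul_right (hhf.zpow_zpow c a')).eq]; group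
    _ = g ^ b * g ^ b' * f ^ a * (h ^ (a * b') * f ^ a') * h ^ c * h ^ c' := by
      rw [zpow_mul_zpow_of_central_commutator hfg hhf hhg]; group
    _ = g ^ (b + b') * f ^ (a + a') * h ^ (c + c' + a * b') := by
      rw [(hhf.zpow_zpow _ a').eq]; group

theorem heisenbergWord_injective (hfg : f * g = h * g * f)
    (hhf : Commute h f) (hhg : Commute h g) (hord : ∀ n : ℤ, n ≠ 0 → h ^ n ≠ 1) :
    Function.Injective (heisenbergWord f g h) := by
  have hinj (m n : ℤ) (hmn : h ^ m = h ^ n) : m = n := by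
    by_contra hne
    exact hord (m - n) (sub_ne_zero.mpr hne) (by rw [zpow_sub, hmn, mul_inv_cancel])
  rintro ⟨a, b, c⟩ ⟨a', b', c'⟩ hpq
  have hmul := heisenbergWord_mul hfg hhf hhg
  have hcomm_f (a b c : ℤ) :
      heisenbergWord f g h (1, 0, 0) * heisenbergWord f g h (a, b, c) =
        heisenbergWord f g h (a, b, c) * heisenbergWord f g h (1, 0, 0) * h ^ b := by
    rw [hmul, hmul]
    simp [heisenbergWord, mul_assoc, ← zpow_add, add_comm]
  have hcomm_g (a b c : ℤ) :
      heisenbergWord f g h (a, b, c) * heisenbergWord f g h (0, 1, 0) =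
        heisenbergWord f g h (0, 1, 0) * heisenbergWord f g h (a, b, c) * h ^ a := by
    rw [hmul, hmul]
    simp [heisenbergWord, mul_assoc, ← zpow_add, add_comm]
  have hb : b = b' := by
    have hf := hcomm_f a b c
    rw [hpq, hcomm_f] at hf
    exact (hinj _ _ (mul_left_cancel hf)).symm
  have ha : a = a' := by
    have hg := hcomm_g a b c
    rw [hpq, hcomm_g] at hg
    exact (hinj _ _ (mul_left_cancel hg)).symm
  subst ha hb
  rw [hinj c c' (mul_left_cancel hpq)]

theorem heisenbergWord_surjective (hfg : f * g = h * g * f)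
    (hhf : Commute h f) (hhg : Commute h g)
    (hgen : Subgroup.closure ({f, g} : Set G) = ⊤) :
    Function.Surjective (heisenbergWord f g h) := by
  let K : Subgroup G :=
    { carrier := Set.range (heisenbergWord f g h)
      one_mem' := ⟨0, by simp [heisenbergWord]⟩
      mul_mem' := by
        rintro _ _ ⟨p, rfl⟩ ⟨q, rfl⟩
        exact ⟨_, (heisenbergWord_mul hfg hhf hhg p q).symm⟩
      inv_mem' := by
        rintro _ ⟨⟨a, b, c⟩, rfl⟩
        refine ⟨(-a, -b, -c + a * b), eq_inv_of_mul_eq_one_left ?_⟩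
        rw [heisenbergWord_mul hfg hhf hhg]
        simp [heisenbergWord] }
  have hK : Subgroup.closure ({f, g} : Set G) ≤ K := by
    rw [Subgroup.closure_le]
    rintro x (rfl | rfl)
    · exact ⟨(1, 0, 0), by simp [heisenbergWord]⟩
    · exact ⟨(0, 1, 0), by simp [heisenbergWord]⟩
  intro x
  exact hK (hgen ▸ Subgroup.mem_top x)

end HeisenbergWord

theorem nonempty_mulEquiv_of_central_commutator {G H : Type*} [Group G] [Group H]
    {f g h : G} {f' g' h' : H}
    (hgen : Subgroup.closure ({f, g} : Set G) = ⊤) (hfg : f * g = h * g * f)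
    (hhf : Commute h f) (hhg : Commute h g) (hord : ∀ n : ℤ, n ≠ 0 → h ^ n ≠ 1)
    (hgen' : Subgroup.closure ({f', g'} : Set H) = ⊤) (hfg' : f' * g' = h' * g' * f')
    (hhf' : Commute h' f') (hhg' : Commute h' g') (hord' : ∀ n : ℤ, n ≠ 0 → h' ^ n ≠ 1) :
    Nonempty (G ≃* H) := by
  let e := Equiv.ofBijective (heisenbergWord f g h)
    ⟨heisenbergWord_injective hfg hhf hhg hord, heisenbergWord_surjective hfg hhf hhg hgen⟩
  let e' := Equiv.ofBijective (heisenbergWord f' g' h')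
    ⟨heisenbergWord_injective hfg' hhf' hhg' hord',
      heisenbergWord_surjective hfg' hhf' hhg' hgen'⟩
  refine ⟨MulEquiv.mk' (e.symm.trans e') fun x y => ?_⟩
  obtain ⟨p, rfl⟩ := e.surjective x
  obtain ⟨q, rfl⟩ := e.surjective y
  have hmul : e p * e q = e (p.1 + q.1, p.2.1 + q.2.1, p.2.2 + q.2.2 + p.1 * q.2.1) :=
    heisenbergWord_mul hfg hhf hhg p q
  rw [hmul]
  simp only [Equiv.trans_apply, Equiv.symm_apply_apply]
  exact (heisenbergWord_mul hfg' hhf' hhg' p q).symm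

/-- The central matrix `Z` of the discrete Heisenberg group. -/
def heisenbergCenter : (Matrix (Fin 3) (Fin 3) ℤ)ˣ where
  val := !![1, 0, 1; 0, 1, 0; 0, 0, 1]
  inv := !![1, 0, -1; 0, 1, 0; 0, 0, 1]
  val_inv := by decide
  inv_val := by decide

theorem heisenbergCenter_pow (n : ℕ) :
    ((heisenbergCenter ^ n : (Matrix (Fin 3) (Fin 3) ℤ)ˣ) : Matrix (Fin 3) (Fin 3) ℤ) =
      !![1, 0, (n : ℤ); 0, 1, 0; 0, 0, 1] := by
  induction n with
  | zero => simp [Matrix.one_fin_three]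
  | succ n ih =>
    rw [pow_succ, Units.val_mul, ih]
    simp [heisenbergCenter, add_comm]

theorem heisenbergCenter_zpow_ne_one (n : ℤ) (hn : n ≠ 0) : heisenbergCenter ^ n ≠ 1 := by
  intro hone
  have hpow : heisenbergCenter ^ n.natAbs = 1 := pow_natAbs_eq_one.mpr hone
  have hval := heisenbergCenter_pow n.natAbs
  rw [hpow] at hval
  have hentry : (1 : Matrix (Fin 3) (Fin 3) ℤ) 0 2 = n.natAbs := by
    simpa using congrArg (fun M : Matrix (Fin 3) (Fin 3) ℤ => M 0 2) hval
  rw [Matrix.one_apply_ne (by decide)] at hentry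
  omega


/-- A group generated by two elements `f`, `g` whose commutator `h = [f,g]` commutes with
both `f` and `g` and has infinite order is isomorphic to the discrete Heisenberg group
(the subgroup of the units of the 3×3 integer matrix ring generated by the standard
matrices `X` and `Y`). -/
theorem stmt13 (G : Type*) [Group G] (f g : G)
    (hgen : Subgroup.closure ({f, g} : Set G) = ⊤)
    (h : G) (hh : h = f * g * f⁻¹ * g⁻¹)
    (hhf : h * f = f * h) (hhg : h * g = g * h)
    (hord : ∀ n : ℤ, n ≠ 0 → h ^ n ≠ 1)
    (X Y : (Matrix (Fin 3) (Fin 3) ℤ)ˣ)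
    (hX : (X : Matrix (Fin 3) (Fin 3) ℤ) = !![1, 1, 0; 0, 1, 0; 0, 0, 1])
    (hY : (Y : Matrix (Fin 3) (Fin 3) ℤ) = !![1, 0, 0; 0, 1, 1; 0, 0, 1]) :
    Nonempty (G ≃* (Subgroup.closure ({X, Y} : Set (Matrix (Fin 3) (Fin 3) ℤ)ˣ))) := by
  have hXY : X * Y = heisenbergCenter * Y * X := by
    ext1
    simp only [Units.val_mul, hX, hY, heisenbergCenter]
    decide
  have hZX : Commute heisenbergCenter X := by
    ext1
    simp only [Units.val_mul, hX, heisenbergCenter]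
    decide
  have hZY : Commute heisenbergCenter Y := by
    ext1
    simp only [Units.val_mul, hY, heisenbergCenter]
    decide
  let K := Subgroup.closure ({X, Y} : Set (Matrix (Fin 3) (Fin 3) ℤ)ˣ)
  have hXK : X ∈ K := Subgroup.subset_closure (by simp)
  have hYK : Y ∈ K := Subgroup.subset_closure (by simp)
  have hZK : heisenbergCenter ∈ K := by
    have hZ : heisenbergCenter = X * Y * X⁻¹ * Y⁻¹ := by rw [hXY]; group
    rw [hZ]
    exact K.mul_mem (K.mul_mem (K.mul_mem hXK hYK) (K.inv_mem hXK)) (K.inv_mem hYK)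
  have hgenK : Subgroup.closure ({⟨X, hXK⟩, ⟨Y, hYK⟩} : Set K) = ⊤ := by
    rw [← Subgroup.closure_closure_coe_preimage]
    congr 1
    ext x
    simp [Subtype.ext_iff]
  exact nonempty_mulEquiv_of_central_commutator (h := h) (h' := (⟨heisenbergCenter, hZK⟩ : K))
    hgen (by rw [hh]; group) hhf hhg hord hgenK (Subtype.ext hXY) (Subtype.ext hZX)
    (Subtype.ext hZY) fun n hn hone =>
      heisenbergCenter_zpow_ne_one n hn (congrArg Subtype.val hone)
end
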